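/- Let u : D^2 → B^n, n ≥ 3, be a proper branched minimal immersion of the unit disk into the Euclidean unit n-ball such that u(D^2) meets ∂B^n orthogonally along its boundary. Then u(D^2) is a totally geodesic equatorial disk, i.e. the intersection of B^n with a 2-dimensional linear subspace through the origin. -/

import Mathlib

/-!
# STATEMENT 3 (Fraser–Schoen 2015)

Let `u : D² → Bⁿ`, `n ≥ 3`, be a proper branched minimal immersion of the unit
disk into the Euclidean unit `n`-ball meeting `∂Bⁿ` orthogonally along its
boundary.  Then `u(D²)` is a totally geodesic equatorial disk, i.e. `Bⁿ ∩ P`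
for a 2-dimensional linear subspace `P ⊆ ℝⁿ` through the origin.

Modelling: a proper branched minimal immersion is a nonconstant branched
conformal harmonic map `u` on the closed unit disk, smooth up to the boundary,
sending `∂D²` into `∂Bⁿ` (properness: boundary, and only the boundary, is sent
to `∂Bⁿ`).  The free boundary condition states that along `∂D²` the outward
normal derivative of `u` is parallel to the position vector `u`.
-/

noncomputable section
open Metric Set
open scoped RealInnerProductSpace

open Complex in
/-- A holomorphic function on the unit disk with real boundary values and a zero at the centre
vanishes. -/
lemma eqOn_zero_of_im_eq_zero_on_sphere {H : ℂ → ℂ} (hH : DiffContOnCl ℂ H (ball 0 1))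
    (h0 : H 0 = 0) (him : ∀ z ∈ sphere (0 : ℂ) 1, (H z).im = 0) :
    ∀ z ∈ closedBall (0 : ℂ) 1, H z = 0 := by
  intro z hz
  have hone : ∀ t : ℝ, exp (I * t * H z) = 1 := by
    intro t
    have hd : DiffContOnCl ℂ (fun w ↦ exp (I * t * H w)) (ball 0 1) :=
      Complex.differentiable_exp.comp_diffContOnCl (hH.const_smul (I * t))
    have hle : ∀ w ∈ closure (ball (0 : ℂ) 1), ‖exp (I * t * H w)‖ ≤ 1 := by
      intro w hw
      refine Complex.norm_le_of_forall_mem_frontier_norm_le isBounded_ball hd ?_ hw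
      intro y hy
      rw [frontier_ball _ one_ne_zero] at hy
      simp [Complex.norm_exp, him y hy]
    have hmax : IsMaxOn (norm ∘ fun w ↦ exp (I * t * H w)) (ball 0 1) 0 := by
      intro w hw
      simpa [h0] using hle w (subset_closure hw)
    simpa [h0] using Complex.eqOn_closedBall_of_isMaxOn_norm hd hmax hz
  have hderiv : HasDerivAt (fun t : ℝ ↦ exp (I * t * H z)) (I * H z) 0 := by
    have h1 : HasDerivAt (fun t : ℝ ↦ I * (t : ℂ) * H z) (I * 1 * H z) 0 :=
      ((Complex.ofRealCLM.hasDerivAt (x := (0 : ℝ))).const_mul I).mul_const (H z)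
    simpa using h1.cexp
  rw [funext hone] at hderiv
  simpa using hderiv.unique (hasDerivAt_const (0 : ℝ) (1 : ℂ))

/-- A holomorphic function on the unit disk vanishing on the boundary vanishes. -/
lemma eqOn_zero_of_eqOn_zero_sphere {H : ℂ → ℂ} (hH : DiffContOnCl ℂ H (ball 0 1))
    (h0 : ∀ z ∈ sphere (0 : ℂ) 1, H z = 0) : ∀ z ∈ closedBall (0 : ℂ) 1, H z = 0 := by
  intro z hz
  rw [← closure_ball _ one_ne_zero] at hz
  refine norm_le_zero_iff.1
    (Complex.norm_le_of_forall_mem_frontier_norm_le isBounded_ball hH ?_ hz)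
  intro w hw
  rw [frontier_ball _ one_ne_zero] at hw
  simp [h0 w hw]

lemma eqOn_closedBall_of_eqOn_ball {X : Type*} [TopologicalSpace X] [T2Space X] {F G : ℂ → X}
    (hF : ContinuousOn F (closedBall 0 1)) (hG : ContinuousOn G (closedBall 0 1))
    (h : EqOn F G (ball 0 1)) : EqOn F G (closedBall 0 1) :=
  h.of_subset_closure hF hG ball_subset_closedBall (closure_ball _ one_ne_zero).ge

/-- Two holomorphic functions with vanishing Wronskian are proportional. -/
lemma eqOn_mul_of_wronskian_eq_zero {U : Set ℂ} (hU : IsOpen U) (hU' : IsPreconnected U)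
    {a b : ℂ → ℂ} (ha : DifferentiableOn ℂ a U) (hb : DifferentiableOn ℂ b U)
    {z₀ : ℂ} (hz₀ : z₀ ∈ U) (haz : a z₀ ≠ 0)
    (hab : ∀ᶠ z in nhds z₀, a z * deriv b z = b z * deriv a z) : ∀ z ∈ U, b z = b z₀ / a z₀ * a z := by
  have hcont : ContinuousAt a z₀ := (ha.differentiableAt (hU.mem_nhds hz₀)).continuousAt
  have hev : ∀ᶠ z in nhds z₀, z ∈ U ∧ a z ≠ 0 ∧ a z * deriv b z = b z * deriv a z :=
    (hU.eventually_mem hz₀).and ((hcont.eventually_ne haz).and hab)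
  obtain ⟨r, hr, hball⟩ := Metric.eventually_nhds_iff_ball.1 hev
  have hdiff : DifferentiableOn ℂ (fun z ↦ b z / a z) (ball z₀ r) := fun z hz ↦
    ((hb.differentiableAt (hU.mem_nhds (hball z hz).1)).div
      (ha.differentiableAt (hU.mem_nhds (hball z hz).1)) (hball z hz).2.1).differentiableWithinAt
  have hzero : EqOn (deriv fun z ↦ b z / a z) 0 (ball z₀ r) := by
    intro z hz
    have h1 := (hb.differentiableAt (hU.mem_nhds (hball z hz).1)).hasDerivAt
    have h2 := (ha.differentiableAt (hU.mem_nhds (hball z hz).1)).hasDerivAt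
    have h3 := (h1.fun_div h2 (hball z hz).2.1).deriv
    rw [h3]
    have := (hball z hz).2.2
    simp only [Pi.zero_apply, div_eq_zero_iff]
    left
    linear_combination this
  have hconst : ∀ z ∈ ball z₀ r, b z / a z = b z₀ / a z₀ := fun z hz ↦
    isOpen_ball.is_const_of_deriv_eq_zero (convex_ball _ _).isPreconnected hdiff hzero hz
      (mem_ball_self hr)
  refine (hb.analyticOnNhd hU).eqOn_of_preconnected_of_eventuallyEq
    ((ha.const_mul _).analyticOnNhd hU) hU' hz₀ ?_
  filter_upwards [ball_mem_nhds z₀ hr] with z hz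
  have h1 := hconst z hz
  rw [← h1]
  field_simp [(hball z hz).2.1]

/-- A nonconstant proper holomorphic self-map of the unit disk is surjective. -/
lemma image_closedBall_eq_closedBall {Φ : ℂ → ℂ} (hΦ : DiffContOnCl ℂ Φ (ball 0 1))
    (hin : ∀ z ∈ ball (0 : ℂ) 1, ‖Φ z‖ < 1) (hbd : ∀ z ∈ sphere (0 : ℂ) 1, ‖Φ z‖ = 1) :
    Φ '' closedBall 0 1 = closedBall 0 1 := by
  have hcont : ContinuousOn Φ (closedBall 0 1) := by
    simpa [closure_ball _ one_ne_zero] using hΦ.continuousOn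
  have hcomp : IsCompact (Φ '' closedBall 0 1) :=
    (isCompact_closedBall 0 1).image_of_continuousOn hcont
  have hsplit : ∀ z ∈ closedBall (0 : ℂ) 1, z ∈ ball (0 : ℂ) 1 ∨ z ∈ sphere (0 : ℂ) 1 := by
    intro z hz
    rw [← ball_union_sphere] at hz
    exact hz
  have hopen : IsOpen (Φ '' ball 0 1) := by
    rcases (hΦ.differentiableOn.analyticOnNhd isOpen_ball).is_constant_or_isOpen
      (convex_ball _ _).isPreconnected with ⟨w, hw⟩ | h
    · exfalso
      have h1 : EqOn Φ (fun _ ↦ w) (closedBall 0 1) :=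
        eqOn_closedBall_of_eqOn_ball hcont continuousOn_const hw
      have h2 := hin 0 (by simp)
      have h3 := hbd 1 (by simp)
      rw [h1 (by simp : (1 : ℂ) ∈ closedBall (0 : ℂ) 1)] at h3
      rw [hw 0 (by simp), h3] at h2
      exact lt_irrefl _ h2
    · exact h _ subset_rfl isOpen_ball
  have hsub : ball (0 : ℂ) 1 ⊆ Φ '' ball 0 1 := by
    refine (convex_ball (0 : ℂ) 1).isPreconnected.subset_left_of_subset_union hopen
      hcomp.isClosed.isOpen_compl ?_ ?_ ?_
    · exact disjoint_compl_right.mono_left (image_mono ball_subset_closedBall)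
    · intro w hw
      by_cases h : w ∈ Φ '' closedBall 0 1
      · left
        obtain ⟨z, hz, rfl⟩ := h
        rcases hsplit z hz with h | h
        · exact ⟨z, h, rfl⟩
        · simp [hbd z h] at hw
      · exact Or.inr h
    · exact ⟨Φ 0, by simpa using hin 0 (by simp), 0, by simp, rfl⟩
  apply Subset.antisymm
  · rintro _ ⟨z, hz, rfl⟩
    rcases hsplit z hz with h | h
    · simpa using (hin z h).le
    · simpa using (hbd z h).le
  · rw [← closure_ball _ one_ne_zero]
    exact closure_minimal (hsub.trans (image_mono subset_closure))
      (by rw [closure_ball _ one_ne_zero]; exact hcomp.isClosed)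

/-- The second fundamental form vanishes along the boundary: in terms of the unit vector `γ`, its
velocity `q`, the normal derivative `l • γ` and their derivatives `q'`, `l' • γ + l • q`. -/
lemma smul_add_eq_smul_of_norm_eq {V : Type*} [NormedAddCommGroup V] [InnerProductSpace ℝ V]
    {γ q q' : V} {l l' : ℝ} (hγ : ⟪γ, γ⟫ = 1) (hγq : ⟪γ, q⟫ = 0) (hq : ⟪q, q⟫ = l ^ 2)
    (hγq' : ⟪γ, q'⟫ = -l ^ 2) (hqq' : ⟪q, q'⟫ = l * l')
    (hn : ⟪l' • γ + l • q, l' • γ + l • q⟫ = ⟪q', q'⟫) :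
    l • (q' + l ^ 2 • γ) = l' • q := by
  rw [← sub_eq_zero, ← inner_self_eq_zero (𝕜 := ℝ)]
  have e1 : ⟪q, γ⟫ = 0 := by rw [real_inner_comm, hγq]
  have e2 : ⟪q', γ⟫ = -l ^ 2 := by rw [real_inner_comm, hγq']
  have e3 : ⟪q', q⟫ = l * l' := by rw [real_inner_comm, hqq']
  simp only [inner_add_left, inner_add_right, inner_sub_left, inner_sub_right, inner_smul_left,
    inner_smul_right, hγ, hγq, hq, hγq', hqq', e1, e2, e3, RCLike.conj_to_real] at hn ⊢
  rw [← hn]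
  ring
lemma uniqueDiffOn_closedUnitDisk : UniqueDiffOn ℝ (closedBall (0 : ℂ) 1) :=
  uniqueDiffOn_convex (convex_closedBall _ _) ⟨0, by simp [interior_closedBall]⟩

lemma closedUnitDisk_mem_nhds {z : ℂ} (hz : z ∈ ball (0 : ℂ) 1) :
    closedBall (0 : ℂ) 1 ∈ nhds z :=
  Filter.mem_of_superset (isOpen_ball.mem_nhds hz) ball_subset_closedBall

open scoped ContDiff

section Boundary

variable {V : Type*} [NormedAddCommGroup V] [NormedSpace ℝ V]

open Complex in
/-- The angular derivative of a map on the closed disk along the boundary circle. -/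
lemma hasDerivAt_circle {F : ℂ → V} (hF : ContDiffOn ℝ ∞ F (closedBall 0 1)) (θ : ℝ) :
    HasDerivAt (fun t : ℝ ↦ F (exp (t * I)))
      (fderivWithin ℝ F (closedBall 0 1) (exp (θ * I)) (I * exp (θ * I))) θ := by
  have hmem : ∀ t : ℝ, exp (t * I) ∈ closedBall (0 : ℂ) 1 := fun t ↦ by
    simp [Complex.norm_exp_ofReal_mul_I]
  have h1 : HasDerivAt (fun t : ℝ ↦ exp ((t : ℂ) * I)) (I * exp (θ * I)) θ := by
    have := ((Complex.ofRealCLM.hasDerivAt (x := θ)).mul_const I).cexp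
    simpa [mul_comm] using this
  have h2 := (hF.differentiableOn (by simp) _ (hmem θ)).hasFDerivWithinAt
  exact h2.comp_hasDerivAt θ h1 (Filter.Eventually.of_forall hmem)

lemma contDiffOn_fderivWithin {F : ℂ → V} (hF : ContDiffOn ℝ ∞ F (closedBall 0 1)) :
    ContDiffOn ℝ ∞ (fderivWithin ℝ F (closedBall 0 1)) (closedBall 0 1) :=
  hF.fderivWithin uniqueDiffOn_closedUnitDisk (by simp)

end Boundary

/-- The Cauchy-Riemann equations extend to the boundary. -/
lemma fderivWithin_I_mul {F : ℂ → ℂ} (hF : ContDiffOn ℝ ∞ F (closedBall 0 1))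
    (hF' : DifferentiableOn ℂ F (ball 0 1)) {z : ℂ} (hz : z ∈ closedBall (0 : ℂ) 1) (ζ : ℂ) :
    fderivWithin ℝ F (closedBall 0 1) z (Complex.I * ζ) =
      Complex.I * fderivWithin ℝ F (closedBall 0 1) z ζ := by
  have hD := (contDiffOn_fderivWithin hF).continuousOn
  refine eqOn_closedBall_of_eqOn_ball
    (F := fun z ↦ fderivWithin ℝ F (closedBall 0 1) z (Complex.I * ζ))
    (G := fun z ↦ Complex.I * fderivWithin ℝ F (closedBall 0 1) z ζ)
    (hD.clm_apply continuousOn_const)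
    (continuousOn_const.mul (hD.clm_apply continuousOn_const)) ?_ hz
  intro w hw
  have := hF'.differentiableAt (isOpen_ball.mem_nhds hw)
  simp only [fderivWithin_of_mem_nhds (closedUnitDisk_mem_nhds hw), this.fderiv_restrictScalars ℝ]
  simpa using (fderiv ℂ F w).map_smul Complex.I ζ

lemma fderivWithin_apply_eq_mul_deriv {F : ℂ → ℂ} (hF : DifferentiableOn ℂ F (ball 0 1)) {z : ℂ}
    (hz : z ∈ ball (0 : ℂ) 1) (ζ : ℂ) :
    fderivWithin ℝ F (closedBall 0 1) z ζ = ζ * deriv F z := by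
  have := hF.differentiableAt (isOpen_ball.mem_nhds hz)
  simp only [fderivWithin_of_mem_nhds (closedUnitDisk_mem_nhds hz), this.fderiv_restrictScalars ℝ]
  simp [fderiv_eq_smul_deriv]

/-- The `j`-th component of `2 ∂U/∂z` for a map `U` on the closed unit disk. -/
def wirtinger {n : ℕ} (U : ℂ → EuclideanSpace ℝ (Fin n)) (j : Fin n) (z : ℂ) : ℂ :=
  (fderivWithin ℝ U (closedBall 0 1) z 1 j : ℂ) -
    Complex.I * (fderivWithin ℝ U (closedBall 0 1) z Complex.I j : ℂ)

section Wirtinger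

variable {n : ℕ} {U : ℂ → EuclideanSpace ℝ (Fin n)}

lemma contDiffOn_wirtinger (hU : ContDiffOn ℝ ∞ U (closedBall 0 1)) (j : Fin n) :
    ContDiffOn ℝ ∞ (wirtinger U j) (closedBall 0 1) := by
  have h : ∀ ζ : ℂ, ContDiffOn ℝ ∞
      (fun z ↦ ((fderivWithin ℝ U (closedBall 0 1) z ζ j : ℝ) : ℂ)) (closedBall 0 1) := fun ζ ↦
    (Complex.ofRealCLM ∘L (EuclideanSpace.proj j : EuclideanSpace ℝ (Fin n) →L[ℝ] ℝ)).contDiff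
      |>.comp_contDiffOn ((contDiffOn_fderivWithin hU).clm_apply contDiffOn_const)
  exact (h 1).sub (contDiffOn_const.mul (h Complex.I))

lemma mul_wirtinger (z : ℂ) (j : Fin n) :
    z * wirtinger U j z = (fderivWithin ℝ U (closedBall 0 1) z z j : ℂ) -
      Complex.I * (fderivWithin ℝ U (closedBall 0 1) z (Complex.I * z) j : ℂ) := by
  have h1 : fderivWithin ℝ U (closedBall 0 1) z z =
      z.re • fderivWithin ℝ U (closedBall 0 1) z 1 +
        z.im • fderivWithin ℝ U (closedBall 0 1) z Complex.I := by
    rw [← map_smul, ← map_smul, ← map_add]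
    congr 1
    simp
  have h2 : fderivWithin ℝ U (closedBall 0 1) z (Complex.I * z) =
      (-z.im) • fderivWithin ℝ U (closedBall 0 1) z 1 +
        z.re • fderivWithin ℝ U (closedBall 0 1) z Complex.I := by
    rw [← map_smul, ← map_smul, ← map_add]
    congr 1
    apply Complex.ext <;> simp
  rw [h1, h2, wirtinger]
  nth_rewrite 1 [← Complex.re_add_im z]
  simp only [PiLp.add_apply, PiLp.smul_apply, smul_eq_mul]
  push_cast
  linear_combination (-(z.im : ℂ) * (fderivWithin ℝ U (closedBall 0 1) z Complex.I j : ℂ)) *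
    Complex.I_mul_I

lemma differentiableOn_wirtinger (hU : ContDiffOn ℝ ∞ U (closedBall 0 1))
    (hharm : ∀ z ∈ ball (0 : ℂ) 1, fderiv ℝ (fderiv ℝ U) z 1 1 +
      fderiv ℝ (fderiv ℝ U) z Complex.I Complex.I = 0) (j : Fin n) :
    DifferentiableOn ℂ (wirtinger U j) (ball 0 1) := by
  intro z hz
  have hU' : ContDiffAt ℝ ∞ U z := hU.contDiffAt (closedUnitDisk_mem_nhds hz)
  have hsymm := hU'.isSymmSndFDerivAt (n := ∞)
    (by simpa using WithTop.coe_le_coe.2 (le_top : (2 : ℕ∞) ≤ ⊤))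
  have hd : DifferentiableAt ℝ (fderiv ℝ U) z :=
    (hU'.fderiv_right (m := ∞) (by simp)).differentiableAt (by simp)
  have hev : wirtinger U j =ᶠ[nhds z] fun w ↦ (fderiv ℝ U w 1 j : ℂ) -
      Complex.I * (fderiv ℝ U w Complex.I j : ℂ) := by
    filter_upwards [isOpen_ball.mem_nhds hz] with w hw
    simp only [wirtinger, fderivWithin_of_mem_nhds (closedUnitDisk_mem_nhds hw)]
  have hc : ∀ ζ : ℂ, HasFDerivAt (fun w ↦ ((fderiv ℝ U w ζ j : ℝ) : ℂ))
      ((Complex.ofRealCLM ∘L (EuclideanSpace.proj j : EuclideanSpace ℝ (Fin n) →L[ℝ] ℝ)) ∘L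
        (ContinuousLinearMap.apply ℝ _ ζ) ∘L fderiv ℝ (fderiv ℝ U) z) z := fun ζ ↦
    ((Complex.ofRealCLM ∘L (EuclideanSpace.proj j : EuclideanSpace ℝ (Fin n) →L[ℝ] ℝ)) ∘L
        (ContinuousLinearMap.apply ℝ _ ζ)).hasFDerivAt.comp z hd.hasFDerivAt
  have hw := ((hc 1).sub ((hc Complex.I).const_mul Complex.I)).congr_of_eventuallyEq hev
  refine (differentiableAt_complex_iff_differentiableAt_real.2
    ⟨hw.differentiableAt, ?_⟩).differentiableWithinAt
  rw [hw.fderiv]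
  have h1 := congrArg (fun v ↦ ((v j : ℝ) : ℂ)) (hharm z hz)
  have h2 := congrArg (fun v ↦ ((v j : ℝ) : ℂ)) (hsymm.eq 1 Complex.I)
  simp at h1 h2 ⊢
  rw [← h2]
  linear_combination (-Complex.I) * h1 +
    (fderiv ℝ (fderiv ℝ U) z 1 Complex.I j : ℂ) * Complex.I_mul_I

end Wirtinger
lemma sum_sub_I_mul_sq {n : ℕ} (a b : EuclideanSpace ℝ (Fin n)) :
    ∑ j, ((a j : ℂ) - Complex.I * (b j : ℂ)) ^ 2 =
      ((⟪a, a⟫ - ⟪b, b⟫ : ℝ) : ℂ) - 2 * Complex.I * (⟪a, b⟫ : ℝ) := by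
  simp only [PiLp.inner_apply, RCLike.inner_apply, RCLike.conj_to_real]
  push_cast
  rw [Finset.mul_sum, ← Finset.sum_sub_distrib, ← Finset.sum_sub_distrib]
  refine Finset.sum_congr rfl fun j _ ↦ ?_
  linear_combination ((b j : ℂ) ^ 2) * Complex.I_sq

lemma re_ofReal_sub_two_mul_I_mul_ofReal (a b : ℝ) :
    ((a : ℂ) - 2 * Complex.I * (b : ℂ)).re = a := by
  simp

lemma im_ofReal_sub_two_mul_I_mul_ofReal (a b : ℝ) :
    ((a : ℂ) - 2 * Complex.I * (b : ℂ)).im = -2 * b := by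
  simp

section FreeBoundary

variable {n : ℕ} {U : ℂ → EuclideanSpace ℝ (Fin n)}

lemma sum_wirtinger_sq (hU : ContDiffOn ℝ ∞ U (closedBall 0 1))
    (hconf : ∀ z ∈ ball (0 : ℂ) 1, ⟪fderiv ℝ U z 1, fderiv ℝ U z Complex.I⟫ = 0 ∧
      ‖fderiv ℝ U z 1‖ = ‖fderiv ℝ U z Complex.I‖) :
    ∀ z ∈ closedBall (0 : ℂ) 1, ∑ j, wirtinger U j z ^ 2 = 0 := by
  refine eqOn_closedBall_of_eqOn_ball (G := fun _ ↦ 0) ?_ continuousOn_const ?_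
  · exact continuousOn_finsetSum _ fun j _ ↦ (contDiffOn_wirtinger hU j).continuousOn.pow 2
  · intro z hz
    simp only [wirtinger, sum_sub_I_mul_sq, fderivWithin_of_mem_nhds (closedUnitDisk_mem_nhds hz)]
    simp [(hconf z hz).1, (hconf z hz).2]

/-- The first and second derivatives of `U` along the boundary, expressed through `z ∂U/∂z` and
its derivative. -/
lemma exists_boundary_frame (hU : ContDiffOn ℝ ∞ U (closedBall 0 1))
    (hconf : ∀ z ∈ ball (0 : ℂ) 1, ⟪fderiv ℝ U z 1, fderiv ℝ U z Complex.I⟫ = 0 ∧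
      ‖fderiv ℝ U z 1‖ = ‖fderiv ℝ U z Complex.I‖)
    (hharm : ∀ z ∈ ball (0 : ℂ) 1, fderiv ℝ (fderiv ℝ U) z 1 1 +
      fderiv ℝ (fderiv ℝ U) z Complex.I Complex.I = 0)
    (hbd : ∀ z ∈ sphere (0 : ℂ) 1, ‖U z‖ = 1)
    (hfree : ∀ z ∈ sphere (0 : ℂ) 1, ∃ c : ℝ, fderivWithin ℝ U (closedBall 0 1) z z = c • U z)
    {z : ℂ} (hz : z ∈ sphere (0 : ℂ) 1) :
    ∃ (l l' : ℝ) (q q' : EuclideanSpace ℝ (Fin n)),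
      ⟪U z, q⟫ = 0 ∧ ⟪q, q⟫ = l ^ 2 ∧ ⟪U z, q'⟫ = -l ^ 2 ∧ ⟪q, q'⟫ = l * l' ∧
      (∀ j, z * wirtinger U j z = ((l • U z) j : ℂ) - Complex.I * (q j : ℂ)) ∧
      ∀ j, fderivWithin ℝ (fun w ↦ w * wirtinger U j w) (closedBall 0 1) z z =
        -Complex.I * (((l' • U z + l • q) j : ℂ) - Complex.I * (q' j : ℂ)) := by
  set e : ℝ → ℂ := fun t ↦ Complex.exp (t * Complex.I) with he
  have hmem : ∀ t, e t ∈ sphere (0 : ℂ) 1 := fun t ↦ by simp [he, Complex.norm_exp_ofReal_mul_I]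
  obtain ⟨θ, rfl⟩ : ∃ θ, e θ = z := by
    refine ⟨z.arg, ?_⟩
    have := Complex.norm_mul_exp_arg_mul_I z
    rw [mem_sphere_zero_iff_norm.1 hz] at this
    simpa using this
  set D := fderivWithin ℝ U (closedBall 0 1) with hD
  have hDs : ContDiffOn ℝ ∞ D (closedBall 0 1) := contDiffOn_fderivWithin hU
  set p : ℝ → EuclideanSpace ℝ (Fin n) := fun t ↦ D (e t) (e t) with hp
  set q : ℝ → EuclideanSpace ℝ (Fin n) := fun t ↦ D (e t) (Complex.I * e t) with hq
  set γ : ℝ → EuclideanSpace ℝ (Fin n) := fun t ↦ U (e t) with hγ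
  have hγd : ∀ t, HasDerivAt γ (q t) t := fun t ↦ hasDerivAt_circle hU t
  obtain ⟨p', hpd⟩ : ∃ p', HasDerivAt p p' θ :=
    ⟨_, hasDerivAt_circle (F := fun w ↦ D w w) (hDs.clm_apply contDiffOn_id) θ⟩
  obtain ⟨q', hqd⟩ : ∃ q', HasDerivAt q q' θ :=
    ⟨_, hasDerivAt_circle (F := fun w ↦ D w (Complex.I * w))
      (hDs.clm_apply (contDiffOn_const.mul contDiffOn_id)) θ⟩
  have hγγ : ∀ t, ⟪γ t, γ t⟫ = 1 := fun t ↦ by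
    rw [real_inner_self_eq_norm_sq, hbd _ (hmem t), one_pow]
  set l : ℝ → ℝ := fun t ↦ ⟪p t, γ t⟫ with hl
  have hpl : ∀ t, p t = l t • γ t := by
    intro t
    obtain ⟨c, hc⟩ := hfree _ (hmem t)
    have hc' : p t = c • γ t := hc
    simp only [hl, hc', inner_smul_left, hγγ, RCLike.conj_to_real, mul_one]
  have hgj : ∀ t j, e t * wirtinger U j (e t) = (p t j : ℂ) - Complex.I * (q t j : ℂ) :=
    fun t j ↦ mul_wirtinger (e t) j
  have hqq : ∀ t, ⟪q t, q t⟫ = l t ^ 2 := by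
    intro t
    have h1 : ∑ j, (e t * wirtinger U j (e t)) ^ 2 = 0 := by
      simp only [mul_pow]
      rw [← Finset.mul_sum, sum_wirtinger_sq hU hconf _ (sphere_subset_closedBall (hmem t)),
        mul_zero]
    simp only [hgj, sum_sub_I_mul_sq] at h1
    have h2 := congrArg Complex.re h1
    rw [re_ofReal_sub_two_mul_I_mul_ofReal, Complex.zero_re] at h2
    have h3 : ⟪p t, p t⟫ = l t ^ 2 := by
      rw [hpl t]
      simp only [inner_smul_left, inner_smul_right, hγγ, RCLike.conj_to_real]
      ring
    linarith
  have hγq : ∀ t, ⟪γ t, q t⟫ = 0 := by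
    intro t
    have h1 := (hγd t).inner ℝ (hγd t)
    rw [funext hγγ] at h1
    have h2 := h1.unique (hasDerivAt_const t (1 : ℝ))
    rw [real_inner_comm (γ t) (q t)] at h2
    linarith
  obtain ⟨l', hld⟩ : ∃ l', HasDerivAt l l' θ := ⟨_, hpd.inner ℝ (hγd θ)⟩
  have hp' : p' = l' • γ θ + l θ • q θ := by
    have h1 := hld.smul (hγd θ)
    have h2 : p = l • γ := funext hpl
    rw [← h2] at h1
    rw [hpd.unique h1, add_comm]
  refine ⟨l θ, l', q θ, q', hγq θ, hqq θ, ?_, ?_, ?_, ?_⟩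
  · have h1 := (hγd θ).inner ℝ hqd
    rw [funext hγq] at h1
    have h2 := h1.unique (hasDerivAt_const θ (0 : ℝ))
    rw [hqq θ] at h2
    change ⟪γ θ, q'⟫ = _
    linarith
  · have h1 := hqd.inner ℝ hqd
    rw [funext hqq] at h1
    have h2 := h1.unique (hld.pow 2)
    rw [real_inner_comm (q θ) q'] at h2
    norm_num at h2
    linarith
  · intro j
    rw [hgj, hpl θ]
  · intro j
    have hgs : ContDiffOn ℝ ∞ (fun w ↦ w * wirtinger U j w) (closedBall 0 1) :=
      contDiffOn_id.mul (contDiffOn_wirtinger hU j)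
    have hgd : DifferentiableOn ℂ (fun w ↦ w * wirtinger U j w) (ball 0 1) :=
      differentiableOn_id.mul (differentiableOn_wirtinger hU hharm j)
    have h1 := hasDerivAt_circle hgs θ
    rw [fderivWithin_I_mul hgs hgd (sphere_subset_closedBall (hmem θ))] at h1
    have hcomp : ∀ {v : ℝ → EuclideanSpace ℝ (Fin n)} {v' : EuclideanSpace ℝ (Fin n)},
        HasDerivAt v v' θ → HasDerivAt (fun t ↦ ((v t j : ℝ) : ℂ)) (v' j : ℂ) θ := fun hv ↦
      (Complex.ofRealCLM ∘L (EuclideanSpace.proj j : EuclideanSpace ℝ (Fin n) →L[ℝ] ℝ))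
        |>.hasFDerivAt.comp_hasDerivAt θ hv
    have h2 := (hcomp hpd).sub ((hcomp hqd).const_mul Complex.I)
    have h3 := h1.unique (h2.congr_of_eventuallyEq
      (Filter.Eventually.of_forall fun t ↦ hgj t j))
    rw [← hp']
    linear_combination (-Complex.I) * h3 +
      fderivWithin ℝ (fun w ↦ w * wirtinger U j w) (closedBall 0 1) (e θ) (e θ) * Complex.I_mul_I

/-- The complex tangent directions `∂U/∂z` at different points are proportional. -/
lemma wirtinger_wronskian_eq_zero (hU : ContDiffOn ℝ ∞ U (closedBall 0 1))
    (hconf : ∀ z ∈ ball (0 : ℂ) 1, ⟪fderiv ℝ U z 1, fderiv ℝ U z Complex.I⟫ = 0 ∧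
      ‖fderiv ℝ U z 1‖ = ‖fderiv ℝ U z Complex.I‖)
    (hharm : ∀ z ∈ ball (0 : ℂ) 1, fderiv ℝ (fderiv ℝ U) z 1 1 +
      fderiv ℝ (fderiv ℝ U) z Complex.I Complex.I = 0)
    (hbd : ∀ z ∈ sphere (0 : ℂ) 1, ‖U z‖ = 1)
    (hfree : ∀ z ∈ sphere (0 : ℂ) 1, ∃ c : ℝ, fderivWithin ℝ U (closedBall 0 1) z z = c • U z)
    (i j : Fin n) {z : ℂ} (hz : z ∈ ball (0 : ℂ) 1) (hz0 : z ≠ 0) :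
      wirtinger U i z * deriv (wirtinger U j) z = wirtinger U j z * deriv (wirtinger U i) z := by
  have hfs := contDiffOn_wirtinger hU
  have hfd := differentiableOn_wirtinger hU hharm
  set g : Fin n → ℂ → ℂ := fun j w ↦ w * wirtinger U j w with hg
  have hgs : ∀ j, ContDiffOn ℝ ∞ (g j) (closedBall 0 1) := fun j ↦ contDiffOn_id.mul (hfs j)
  have hgd : ∀ j, DifferentiableOn ℂ (g j) (ball 0 1) := fun j ↦ differentiableOn_id.mul (hfd j)
  set h : Fin n → ℂ → ℂ := fun j w ↦ fderivWithin ℝ (g j) (closedBall 0 1) w w with hh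
  have hgc : ∀ j, DiffContOnCl ℂ (g j) (ball 0 1) := fun j ↦
    ⟨hgd j, by simpa [closure_ball _ one_ne_zero] using (hgs j).continuousOn⟩
  have hhe : ∀ j, ∀ z ∈ ball (0 : ℂ) 1, h j z = z * deriv (g j) z := fun j z hz ↦
    fderivWithin_apply_eq_mul_deriv (hgd j) hz z
  have hhc : ∀ j, DiffContOnCl ℂ (h j) (ball 0 1) := by
    refine fun j ↦ ⟨?_, ?_⟩
    · exact (differentiableOn_id.mul ((hgd j).deriv isOpen_ball)).congr (hhe j)
    · rw [closure_ball _ one_ne_zero]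
      exact (contDiffOn_fderivWithin (hgs j)).continuousOn.clm_apply continuousOn_id
  have hframe := fun z (hz : z ∈ sphere (0 : ℂ) 1) ↦
    exists_boundary_frame hU hconf hharm hbd hfree hz
  have hγγ : ∀ z ∈ sphere (0 : ℂ) 1, ⟪U z, U z⟫ = 1 := fun z hz ↦ by
    rw [real_inner_self_eq_norm_sq, hbd _ hz, one_pow]
  have hsum : ∀ (l' l : ℝ) (v w q' : EuclideanSpace ℝ (Fin n)),
      ∑ j, (-Complex.I * (((l' • v + l • w) j : ℂ) - Complex.I * (q' j : ℂ))) ^ 2 =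
      -(((⟪l' • v + l • w, l' • v + l • w⟫ - ⟪q', q'⟫ : ℝ) : ℂ) -
        2 * Complex.I * (⟪l' • v + l • w, q'⟫ : ℝ)) := by
    intro l' l v w q'
    rw [← sum_sub_I_mul_sq]
    simp only [mul_pow]
    rw [← Finset.mul_sum]
    simp
  have hH : ∀ z ∈ closedBall (0 : ℂ) 1, ∑ j, h j z ^ 2 = 0 := by
    refine eqOn_zero_of_im_eq_zero_on_sphere (H := fun z ↦ ∑ j, h j z ^ 2) ?_ ?_ ?_
    · refine ⟨?_, ?_⟩
      · exact DifferentiableOn.fun_sum fun j _ ↦ (hhc j).differentiableOn.pow 2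
      · exact continuousOn_finsetSum _ fun j _ ↦ (hhc j).continuousOn.pow 2
    · simp [hh]
    · intro z hz
      obtain ⟨l, l', q, q', h1, h2, h3, h4, h5, h6⟩ := hframe z hz
      have h6' : ∀ j, h j z = _ := h6
      simp only [h6', hsum]
      have : ⟪l' • U z + l • q, q'⟫ = 0 := by
        rw [inner_add_left, inner_smul_left, inner_smul_left, h3, h4]
        simp
        ring
      rw [this, Complex.neg_im, im_ofReal_sub_two_mul_I_mul_ofReal]
      simp
  have hW : ∀ z ∈ closedBall (0 : ℂ) 1, g i z * h j z - g j z * h i z = 0 := by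
    refine eqOn_zero_of_eqOn_zero_sphere (H := fun z ↦ g i z * h j z - g j z * h i z) ?_ ?_
    · refine ⟨?_, ?_⟩
      · exact ((hgc i).differentiableOn.mul (hhc j).differentiableOn).sub
          ((hgc j).differentiableOn.mul (hhc i).differentiableOn)
      · exact ((hgc i).continuousOn.mul (hhc j).continuousOn).sub
          ((hgc j).continuousOn.mul (hhc i).continuousOn)
    · intro z hz
      obtain ⟨l, l', q, q', h1, h2, h3, h4, h5, h6⟩ := hframe z hz
      have h5' : ∀ j, g j z = _ := h5
      have h6' : ∀ j, h j z = _ := h6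
      have h7 := hH z (sphere_subset_closedBall hz)
      simp only [h6', hsum] at h7
      have h8 := congrArg Complex.re h7
      rw [Complex.neg_re, re_ofReal_sub_two_mul_I_mul_ofReal, Complex.zero_re] at h8
      have hn : ⟪l' • U z + l • q, l' • U z + l • q⟫ = ⟪q', q'⟫ := by
        linarith
      have h9 := smul_add_eq_smul_of_norm_eq (hγγ z hz) h1 h2 h3 h4 hn
      by_cases hl : l = 0
      · subst hl
        have hq : q = 0 := by simpa using h2
        have : ∀ j, g j z = 0 := fun j ↦ by simp [h5', hq]
        simp [this]
      · have h10 : ∀ j, (l : ℂ) * h j z = (l ^ 2 - Complex.I * l') * g j z := by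
          intro j
          have h11 := congrArg (fun v ↦ ((v j : ℝ) : ℂ)) h9
          simp only [PiLp.add_apply, PiLp.smul_apply, smul_eq_mul] at h11
          push_cast at h11
          rw [h5', h6']
          simp only [PiLp.add_apply, PiLp.smul_apply, smul_eq_mul]
          push_cast
          linear_combination (l * q' j - l' * q j : ℂ) * Complex.I_sq - h11
        have hl' : (l : ℂ) ≠ 0 := by exact_mod_cast hl
        apply mul_left_cancel₀ hl'
        linear_combination g i z * h10 j - g j z * h10 i
  have hgderiv : ∀ j, deriv (g j) z = wirtinger U j z + z * deriv (wirtinger U j) z := by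
    intro j
    have h1 := ((hfd j).differentiableAt (isOpen_ball.mem_nhds hz)).hasDerivAt
    simpa [hg] using ((hasDerivAt_id' z).fun_mul h1).deriv
  have h1 := hW z (ball_subset_closedBall hz)
  rw [hhe i z hz, hhe j z hz, hgderiv, hgderiv] at h1
  apply mul_left_cancel₀ (pow_ne_zero 3 hz0)
  simp only [hg] at h1
  linear_combination h1

/-- If `∂U/∂z` has a constant complex direction, then `U` is, up to an affine isometry, a
holomorphic function, whose derivative is denoted `φ`. -/
lemma exists_orthonormal_frame (hU : ContDiffOn ℝ ∞ U (closedBall 0 1))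
    (hconf : ∀ z ∈ ball (0 : ℂ) 1, ⟪fderiv ℝ U z 1, fderiv ℝ U z Complex.I⟫ = 0 ∧
      ‖fderiv ℝ U z 1‖ = ‖fderiv ℝ U z Complex.I‖)
    (hharm : ∀ z ∈ ball (0 : ℂ) 1, fderiv ℝ (fderiv ℝ U) z 1 1 +
      fderiv ℝ (fderiv ℝ U) z Complex.I Complex.I = 0)
    (hin : ‖U 0‖ < 1) (hbd : ∀ z ∈ sphere (0 : ℂ) 1, ‖U z‖ = 1)
    (hfree : ∀ z ∈ sphere (0 : ℂ) 1, ∃ c : ℝ, fderivWithin ℝ U (closedBall 0 1) z z = c • U z) :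
    ∃ (e₁ e₂ : EuclideanSpace ℝ (Fin n)) (φ : ℂ → ℂ), ⟪e₁, e₁⟫ = 1 ∧ ⟪e₂, e₂⟫ = 1 ∧ ⟪e₁, e₂⟫ = 0 ∧
      (∀ z ∈ closedBall (0 : ℂ) 1, ∀ ζ : ℂ, fderivWithin ℝ U (closedBall 0 1) z ζ =
        (ζ * φ z).re • e₁ + (ζ * φ z).im • e₂) ∧ ∃ z ∈ sphere (0 : ℂ) 1, φ z ≠ 0 := by
  have hfs := contDiffOn_wirtinger hU
  have hfd := differentiableOn_wirtinger hU hharm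
  have hlin : ∀ z ζ : ℂ, fderivWithin ℝ U (closedBall 0 1) z ζ =
      ζ.re • fderivWithin ℝ U (closedBall 0 1) z 1 +
        ζ.im • fderivWithin ℝ U (closedBall 0 1) z Complex.I := by
    intro z ζ
    rw [← map_smul, ← map_smul, ← map_add]
    congr 1
    simp
  obtain ⟨i, z₀, hz₀, hz₀', hi⟩ : ∃ i, ∃ z ∈ ball (0 : ℂ) 1, z ≠ 0 ∧ wirtinger U i z ≠ 0 := by
    by_contra! hcon
    have h1 : ∀ i, EqOn (wirtinger U i) (fun _ ↦ 0) (closedBall 0 1) := by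
      intro i
      refine EqOn.of_subset_closure (s := ball (0 : ℂ) 1 ∩ {0}ᶜ) (fun z hz ↦ hcon i z hz.1 hz.2)
        (hfs i).continuousOn continuousOn_const
        (inter_subset_left.trans ball_subset_closedBall) ?_
      rw [← closure_ball _ one_ne_zero]
      exact closure_minimal ((dense_compl_singleton 0).open_subset_closure_inter isOpen_ball)
        isClosed_closure
    have h2 : ∀ z ∈ closedBall (0 : ℂ) 1, fderivWithin ℝ U (closedBall 0 1) z = 0 := by
      intro z hz
      ext ζ j
      have h3 : wirtinger U j z = 0 := h1 j hz
      have h4 := congrArg Complex.re h3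
      have h5 := congrArg Complex.im h3
      simp [wirtinger] at h4 h5
      rw [hlin]
      simp [h4, h5]
    have h3 := (convex_closedBall (0 : ℂ) 1).is_const_of_fderivWithin_eq_zero
      (hU.differentiableOn (by simp)) h2 (x := 0) (y := 1) (by simp) (by simp)
    rw [h3, hbd 1 (by simp)] at hin
    exact lt_irrefl _ hin
  set v : Fin n → ℂ := fun j ↦ wirtinger U j z₀ / wirtinger U i z₀ with hv
  have hfv : ∀ j, ∀ z ∈ closedBall (0 : ℂ) 1, wirtinger U j z = v j * wirtinger U i z := by
    intro j
    refine eqOn_closedBall_of_eqOn_ball (hfs j).continuousOn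
      (continuousOn_const.mul (hfs i).continuousOn) ?_
    refine eqOn_mul_of_wronskian_eq_zero isOpen_ball (convex_ball _ _).isPreconnected (hfd i)
      (hfd j) hz₀ hi ?_
    filter_upwards [isOpen_ball.mem_nhds hz₀, isOpen_ne.mem_nhds hz₀'] with z hz hz'
    exact wirtinger_wronskian_eq_zero hU hconf hharm hbd hfree i j hz hz'
  set a : EuclideanSpace ℝ (Fin n) := WithLp.toLp 2 fun j ↦ (v j).re with ha
  set b : EuclideanSpace ℝ (Fin n) := WithLp.toLp 2 fun j ↦ -(v j).im with hb
  have hvab : ∀ j, v j = (a j : ℂ) - Complex.I * (b j : ℂ) := by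
    intro j
    apply Complex.ext <;> simp [ha, hb]
  have hv2 : ∑ j, v j ^ 2 = 0 := by
    have h1 := sum_wirtinger_sq hU hconf z₀ (ball_subset_closedBall hz₀)
    simp only [hv, div_pow]
    rw [← Finset.sum_div, h1, zero_div]
  simp only [hvab, sum_sub_I_mul_sq] at hv2
  have hab : ⟪a, b⟫ = 0 := by
    have := congrArg Complex.im hv2
    rw [im_ofReal_sub_two_mul_I_mul_ofReal, Complex.zero_im] at this
    linarith
  have haabb : ⟪b, b⟫ = ⟪a, a⟫ := by
    have := congrArg Complex.re hv2
    rw [re_ofReal_sub_two_mul_I_mul_ofReal, Complex.zero_re] at this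
    linarith
  have ha0 : ‖a‖ ≠ 0 := by
    intro h
    have h1 : a i = 0 := by rw [norm_eq_zero.1 h]; rfl
    simp [ha, hv, div_self hi] at h1
  have haa : ⟪a, a⟫ = ‖a‖ ^ 2 := real_inner_self_eq_norm_sq a
  refine ⟨‖a‖⁻¹ • a, ‖a‖⁻¹ • b, fun z ↦ ‖a‖ * wirtinger U i z, ?_, ?_, ?_, ?_, ?_⟩
  · rw [inner_smul_left, inner_smul_right, haa, RCLike.conj_to_real]
    field_simp
  · rw [inner_smul_left, inner_smul_right, haabb, haa, RCLike.conj_to_real]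
    field_simp
  · rw [inner_smul_left, inner_smul_right, hab]
    simp
  · intro z hz ζ
    ext j
    have h3 := hfv j z hz
    have h4 := congrArg Complex.re h3
    have h5 := congrArg Complex.im h3
    rw [hvab, wirtinger] at h4 h5
    beta_reduce
    generalize wirtinger U i z = w at h4 h5 ⊢
    simp at h4 h5
    rw [hlin]
    simp [h4]
    field_simp
    linear_combination (-ζ.im) * h5
  · by_contra! hcon
    refine hi (eqOn_zero_of_eqOn_zero_sphere
      ⟨hfd i, by simpa [closure_ball _ one_ne_zero] using (hfs i).continuousOn⟩ ?_ z₀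
      (ball_subset_closedBall hz₀))
    intro z hz
    simpa [ha0] using hcon z hz

/-- The Fraser-Schoen theorem for maps defined on the closed unit disk of `ℂ`. -/
theorem exists_submodule_image_eq (hU : ContDiffOn ℝ ∞ U (closedBall 0 1))
    (hconf : ∀ z ∈ ball (0 : ℂ) 1, ⟪fderiv ℝ U z 1, fderiv ℝ U z Complex.I⟫ = 0 ∧
      ‖fderiv ℝ U z 1‖ = ‖fderiv ℝ U z Complex.I‖)
    (hharm : ∀ z ∈ ball (0 : ℂ) 1, fderiv ℝ (fderiv ℝ U) z 1 1 +
      fderiv ℝ (fderiv ℝ U) z Complex.I Complex.I = 0)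
    (hin : ∀ z ∈ ball (0 : ℂ) 1, ‖U z‖ < 1) (hbd : ∀ z ∈ sphere (0 : ℂ) 1, ‖U z‖ = 1)
    (hfree : ∀ z ∈ sphere (0 : ℂ) 1, ∃ c : ℝ, fderivWithin ℝ U (closedBall 0 1) z z = c • U z) :
    ∃ P : Submodule ℝ (EuclideanSpace ℝ (Fin n)), Module.finrank ℝ P = 2 ∧
      U '' closedBall 0 1 = closedBall 0 1 ∩ (P : Set (EuclideanSpace ℝ (Fin n))) := by
  obtain ⟨e₁, e₂, φ, h11, h22, h12, hD, z₁, hz₁, hφ⟩ :=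
    exists_orthonormal_frame hU hconf hharm (hin 0 (by simp)) hbd hfree
  have h21 : ⟪e₂, e₁⟫ = 0 := by rw [real_inner_comm, h12]
  have hn1 : ‖e₁‖ = 1 := by rw [norm_eq_sqrt_real_inner, h11, Real.sqrt_one]
  have hn2 : ‖e₂‖ = 1 := by rw [norm_eq_sqrt_real_inner, h22, Real.sqrt_one]
  have hUd := hU.differentiableOn (by simp)
  have hT : ∀ x y : ℝ, ‖x • e₁ + y • e₂‖ ^ 2 = x ^ 2 + y ^ 2 := by
    intro x y
    rw [← real_inner_self_eq_norm_sq]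
    simp only [inner_add_left, inner_add_right, inner_smul_left, inner_smul_right, h11, h22, h12,
      h21, RCLike.conj_to_real]
    ring
  -- `U` takes values in the span of `e₁` and `e₂`
  have hplane : ∀ z ∈ closedBall (0 : ℂ) 1, U z = ⟪e₁, U z⟫ • e₁ + ⟪e₂, U z⟫ • e₂ := by
    set R : EuclideanSpace ℝ (Fin n) →L[ℝ] EuclideanSpace ℝ (Fin n) :=
      ContinuousLinearMap.id ℝ _ - (innerSL ℝ e₁).smulRight e₁ - (innerSL ℝ e₂).smulRight e₂
      with hR
    have hRv : ∀ w, R w = w - ⟪e₁, w⟫ • e₁ - ⟪e₂, w⟫ • e₂ := fun w ↦ rfl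
    have hR0 : ∀ x y : ℝ, R (x • e₁ + y • e₂) = 0 := by
      intro x y
      simp [hRv, inner_add_right, inner_smul_right, hn1, hn2, h12, h21]
    have hconst : ∀ z ∈ closedBall (0 : ℂ) 1, R (U z) = R (U z₁) := by
      intro z hz
      refine (convex_closedBall (0 : ℂ) 1).is_const_of_fderivWithin_eq_zero (𝕜 := ℝ)
        (f := fun z ↦ R (U z)) (fun w hw ↦ ?_) (fun w hw ↦ ?_) hz (sphere_subset_closedBall hz₁)
      · exact (R.hasFDerivAt.comp_hasFDerivWithinAt w
          (hUd w hw).hasFDerivWithinAt).differentiableWithinAt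
      · have h1 := (R.hasFDerivAt.comp_hasFDerivWithinAt w
          (hUd w hw).hasFDerivWithinAt).fderivWithin (uniqueDiffOn_closedUnitDisk w hw)
        refine h1.trans ?_
        ext1 ζ
        simp [hD w hw, hR0, -map_add]
    have hz₁R : R (U z₁) = 0 := by
      obtain ⟨c, hc⟩ := hfree z₁ hz₁
      rw [hD z₁ (sphere_subset_closedBall hz₁)] at hc
      have hc0 : c ≠ 0 := by
        rintro rfl
        have h1 := hT (z₁ * φ z₁).re (z₁ * φ z₁).im
        rw [hc] at h1
        have h2 : z₁ ≠ 0 := by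
          rintro rfl
          simp at hz₁
        have h3 : Complex.normSq (z₁ * φ z₁) = 0 := by
          rw [Complex.normSq_apply]
          simp at h1 ⊢
          linarith
        exact mul_ne_zero h2 hφ (Complex.normSq_eq_zero.1 h3)
      have h1 := congrArg R hc
      rw [hR0, map_smul] at h1
      exact (smul_eq_zero.1 h1.symm).resolve_left hc0
    intro z hz
    have h1 := hconst z hz
    rw [hz₁R, hRv, sub_sub, sub_eq_zero] at h1
    exact h1
  -- the holomorphic coordinate of `U` in this plane
  set Φ : ℂ → ℂ := fun z ↦ (⟪e₁, U z⟫ : ℂ) + Complex.I * (⟪e₂, U z⟫ : ℂ) with hΦ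
  have hre : ∀ z, (Φ z).re = ⟪e₁, U z⟫ := fun z ↦ by simp [hΦ]
  have him : ∀ z, (Φ z).im = ⟪e₂, U z⟫ := fun z ↦ by simp [hΦ]
  have hUΦ : ∀ z ∈ closedBall (0 : ℂ) 1, U z = (Φ z).re • e₁ + (Φ z).im • e₂ := by
    intro z hz
    rw [hre, him, ← hplane z hz]
  have hTn : ∀ w : ℂ, ‖w.re • e₁ + w.im • e₂‖ = ‖w‖ := by
    intro w
    rw [← sq_eq_sq₀ (norm_nonneg _) (norm_nonneg _), hT, Complex.sq_norm, Complex.normSq_apply]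
    ring
  have hnorm : ∀ z ∈ closedBall (0 : ℂ) 1, ‖Φ z‖ = ‖U z‖ := by
    intro z hz
    rw [hUΦ z hz, hTn]
  set L : EuclideanSpace ℝ (Fin n) →L[ℝ] ℂ :=
    Complex.ofRealCLM ∘L innerSL ℝ e₁ + Complex.I • (Complex.ofRealCLM ∘L innerSL ℝ e₂) with hL
  have hΦc : DiffContOnCl ℂ Φ (ball 0 1) := by
    refine ⟨fun z hz ↦ ?_, ?_⟩
    · have hz' := ball_subset_closedBall hz
      have h1 : HasFDerivAt Φ (L ∘L fderivWithin ℝ U (closedBall 0 1) z) z :=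
        L.hasFDerivAt.comp z
          ((hUd z hz').hasFDerivWithinAt.hasFDerivAt (closedUnitDisk_mem_nhds hz))
      refine (differentiableAt_complex_iff_differentiableAt_real.2
        ⟨h1.differentiableAt, ?_⟩).differentiableWithinAt
      rw [h1.fderiv]
      apply Complex.ext <;>
        simp [hL, hD z hz', inner_add_right, inner_smul_right, hn1, hn2, h12, h21]
    · rw [closure_ball _ one_ne_zero]
      exact L.continuous.comp_continuousOn hU.continuousOn
  have himage := image_closedBall_eq_closedBall hΦc
    (fun z hz ↦ by rw [hnorm z (ball_subset_closedBall hz)]; exact hin z hz)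
    (fun z hz ↦ by rw [hnorm z (sphere_subset_closedBall hz)]; exact hbd z hz)
  have horth : Orthonormal ℝ ![e₁, e₂] := by
    rw [orthonormal_iff_ite]
    intro i j
    fin_cases i <;> fin_cases j <;> simp [h12, h21, hn1, hn2]
  refine ⟨Submodule.span ℝ (range ![e₁, e₂]), ?_, ?_⟩
  · rw [finrank_span_eq_card horth.linearIndependent, Fintype.card_fin]
  · have hmem : ∀ x, x ∈ Submodule.span ℝ (range ![e₁, e₂]) ↔ ∃ s t : ℝ, s • e₁ + t • e₂ = x := by
      intro x
      rw [Matrix.range_cons_cons_empty, Submodule.mem_span_pair]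
    ext x
    simp only [mem_inter_iff, SetLike.mem_coe, hmem, mem_closedBall_zero_iff, mem_image]
    constructor
    · rintro ⟨z, hz, rfl⟩
      rw [← mem_closedBall_zero_iff] at hz
      refine ⟨?_, _, _, (hUΦ z hz).symm⟩
      rw [← hnorm z hz, ← mem_closedBall_zero_iff, ← himage]
      exact mem_image_of_mem _ hz
    · rintro ⟨hx, s, t, rfl⟩
      have hw : (⟨s, t⟩ : ℂ) ∈ closedBall (0 : ℂ) 1 := by
        rw [mem_closedBall_zero_iff, ← hTn]
        exact hx
      rw [← himage] at hw
      obtain ⟨z, hz, hzw⟩ := hw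
      exact ⟨z, by simpa using hz, by rw [hUΦ z hz, hzw]⟩

end FreeBoundary

/-- **Fraser–Schoen**: free boundary branched minimal immersions of the disk
into `Bⁿ` are equatorial disks, in every dimension `n ≥ 3`. -/
theorem fraser_schoen_free_boundary_minimal_disk
    (n : ℕ) (hn : 3 ≤ n)
    (u : EuclideanSpace ℝ (Fin 2) → EuclideanSpace ℝ (Fin n))
    -- smooth up to the boundary on the closed unit disk
    (hsm : ContDiffOn ℝ (⊤ : ℕ∞) u (closedBall 0 1))
    -- `u` is nonconstant
    (hnc : ∃ x ∈ closedBall (0 : EuclideanSpace ℝ (Fin 2)) 1,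
      ∃ y ∈ closedBall (0 : EuclideanSpace ℝ (Fin 2)) 1, u x ≠ u y)
    -- conformality (branch points, where the derivative vanishes, are allowed):
    (hconf : ∀ x ∈ ball (0 : EuclideanSpace ℝ (Fin 2)) 1,
      ⟪fderiv ℝ u x (EuclideanSpace.single 0 1),
        fderiv ℝ u x (EuclideanSpace.single 1 1)⟫ = 0 ∧
      ‖fderiv ℝ u x (EuclideanSpace.single 0 1)‖ =
        ‖fderiv ℝ u x (EuclideanSpace.single 1 1)‖)
    -- harmonicity: a branched conformal harmonic map is a branched minimal immersion
    (hharm : ∀ x ∈ ball (0 : EuclideanSpace ℝ (Fin 2)) 1,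
      iteratedFDeriv ℝ 2 u x ![EuclideanSpace.single 0 1, EuclideanSpace.single 0 1] +
        iteratedFDeriv ℝ 2 u x ![EuclideanSpace.single 1 1, EuclideanSpace.single 1 1] = 0)
    -- the disk is mapped into the closed unit ball
    (hball : ∀ x ∈ closedBall (0 : EuclideanSpace ℝ (Fin 2)) 1,
      u x ∈ closedBall (0 : EuclideanSpace ℝ (Fin n)) 1)
    -- properness: the boundary circle, and only it, is mapped into `∂Bⁿ`
    (hproper : ∀ x ∈ closedBall (0 : EuclideanSpace ℝ (Fin 2)) 1,
      (u x ∈ sphere (0 : EuclideanSpace ℝ (Fin n)) 1 ↔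
        x ∈ sphere (0 : EuclideanSpace ℝ (Fin 2)) 1))
    -- free boundary condition: `u(D²)` meets `∂Bⁿ` orthogonally along its boundary
    (hfree : ∀ x ∈ sphere (0 : EuclideanSpace ℝ (Fin 2)) 1,
      ∃ c : ℝ, fderivWithin ℝ u (closedBall 0 1) x x = c • u x) :
    -- conclusion: the image is a totally geodesic equatorial disk
    ∃ P : Submodule ℝ (EuclideanSpace ℝ (Fin n)),
      Module.finrank ℝ P = 2 ∧
      u '' closedBall 0 1 = closedBall 0 1 ∩ (P : Set (EuclideanSpace ℝ (Fin n))) := by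
  
  set e : ℂ ≃ₗᵢ[ℝ] EuclideanSpace ℝ (Fin 2) := Complex.orthonormalBasisOneI.repr with he
  have he1 : e 1 = EuclideanSpace.single 0 1 := by
    have := Complex.orthonormalBasisOneI.repr_self 0
    simpa using this
  have heI : e Complex.I = EuclideanSpace.single 1 1 := by
    have := Complex.orthonormalBasisOneI.repr_self 1
    simpa using this
  have hpre : e ⁻¹' closedBall 0 1 = closedBall 0 1 := by simp
  have hmem : ∀ z, z ∈ closedBall (0 : ℂ) 1 ↔ e z ∈ closedBall 0 1 := by simp
  have hmem' : ∀ z, z ∈ ball (0 : ℂ) 1 ↔ e z ∈ ball 0 1 := by simp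
  have hmem'' : ∀ z, z ∈ sphere (0 : ℂ) 1 ↔ e z ∈ sphere 0 1 := by simp
  have hfd : ∀ z ζ, fderiv ℝ (u ∘ e) z ζ = fderiv ℝ u (e z) (e ζ) := by
    intro z ζ
    have := e.toContinuousLinearEquiv.comp_right_fderiv (f := u) (x := z)
    exact congrArg (fun A ↦ A ζ) this
  have hfd2 : ∀ z ζ, fderiv ℝ (fderiv ℝ (u ∘ e)) z ζ ζ =
      fderiv ℝ (fderiv ℝ u) (e z) (e ζ) (e ζ) := by
    intro z ζ
    have h1 := congrArg (fun A ↦ A ![ζ, ζ])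
      (e.toContinuousLinearEquiv.iteratedFDerivWithin_comp_right u
        uniqueDiffOn_univ (mem_univ (e z)) 2)
    simpa [iteratedFDerivWithin_univ, iteratedFDeriv_two_apply] using h1
  have himage : u '' closedBall 0 1 = (u ∘ e) '' closedBall 0 1 := by
    rw [image_comp, e.image_closedBall, map_zero]
  rw [himage]
  refine exists_submodule_image_eq ?_ ?_ ?_ ?_ ?_ ?_
  · rw [← hpre]
    exact hsm.comp e.contDiff.contDiffOn fun _ h ↦ h
  · intro z hz
    rw [hfd, hfd, he1, heI]
    exact hconf _ ((hmem' z).1 hz)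
  · intro z hz
    rw [hfd2, hfd2, he1, heI]
    simpa [iteratedFDeriv_two_apply] using hharm _ ((hmem' z).1 hz)
  · intro z hz
    have hz' := ball_subset_closedBall ((hmem' z).1 hz)
    refine lt_of_le_of_ne (by simpa using hball _ hz') fun h ↦ ?_
    have h1 := (hproper _ hz').1 (by simpa using h)
    exact (mem_ball_zero_iff.1 ((hmem' z).1 hz)).ne (by simpa using h1)
  · intro z hz
    simpa using (hproper _ (sphere_subset_closedBall ((hmem'' z).1 hz))).2 ((hmem'' z).1 hz)
  · intro z hz
    obtain ⟨c, hc⟩ := hfree _ ((hmem'' z).1 hz)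
    refine ⟨c, hc ▸ ?_⟩
    have h1 := e.toContinuousLinearEquiv.comp_right_fderivWithin (f := u) (s := closedBall 0 1)
      (x := z) (by
        have := uniqueDiffOn_closedUnitDisk z (sphere_subset_closedBall hz)
        rwa [← hpre] at this)
    have h2 := congrArg (fun A ↦ A z) h1
    have h3 : (e.toContinuousLinearEquiv : ℂ → EuclideanSpace ℝ (Fin 2)) ⁻¹' closedBall 0 1 =
      closedBall 0 1 := hpre
    rw [h3] at h2
    exact h2
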